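/- Let $C(z,u)$ be a power series with non-negative coefficients such that $z$ divides $C(z,u)$ and $u^2$ does not divide $C(z,u)$, and let $u_{1,2}(z)=g(z)\pm\sqrt{h(z)}$ be the two solutions with $u(0)=0$ of $u^2=C(z,u)$ (so $g=(u_1+u_2)/2$, $h=((u_1-u_2)/2)^2$). Then $g(z)$ and $h(z)$ are power series with $g(0)=h(0)=0$ and all coefficients non-negative. -/

import Mathlib

/-- Coefficient of `z ^ n` in the family `X j` of power series solving
`X 0 = C 0 + X 0 * X 2` and `X j = C j + X 1 * X (j + 1) + X 0 * X (j + 2)` for `j ≥ 1`.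
It encodes the factorization
`u ^ 2 - C(z, u) = (u ^ 2 - X 1 * u - X 0) * (1 - ∑ k, X (k + 2) * u ^ k)`. -/
noncomputable def factorCoeff (C : ℕ → ℕ → ℝ) : ℕ → ℕ → ℝ
  | 0, _ => 0
  | n + 1, j => C (n + 1) j + ∑ a : Fin n,
      ((if j = 0 then 0 else factorCoeff C (a + 1) 1 * factorCoeff C (n - a) (j + 1)) +
        factorCoeff C (a + 1) 0 * factorCoeff C (n - a) (j + 2))
  termination_by n => n
  decreasing_by all_goals omega

theorem factorCoeff_zero (C : ℕ → ℕ → ℝ) (j : ℕ) : factorCoeff C 0 j = 0 := by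
  rw [factorCoeff]

theorem factorCoeff_nonneg {C : ℕ → ℕ → ℝ} (hC : ∀ i k, 0 ≤ C i k) (n j : ℕ) :
    0 ≤ factorCoeff C n j := by
  induction n using Nat.strong_induction_on generalizing j with
  | _ n ih =>
    cases n with
    | zero => rw [factorCoeff_zero]
    | succ n =>
      rw [factorCoeff]
      refine add_nonneg (hC _ _) (Finset.sum_nonneg fun a _ => add_nonneg ?_ ?_)
      · split_ifs
        · exact le_rfl
        · exact mul_nonneg (ih _ (by omega) _) (ih _ (by omega) _)
      · exact mul_nonneg (ih _ (by omega) _) (ih _ (by omega) _)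

theorem sum_antidiagonal_succ_eq_sum_fin {f g : ℕ → ℝ} (hf : f 0 = 0) (hg : g 0 = 0) (n : ℕ) :
    ∑ x ∈ Finset.HasAntidiagonal.antidiagonal (n + 1), f x.1 * g x.2 = ∑ a : Fin n, f (a + 1) * g (n - a) := by
  rw [Finset.Nat.sum_antidiagonal_eq_sum_range_succ (fun i j => f i * g j),
    Finset.sum_range_succ, Finset.sum_range_succ',
    Fin.sum_univ_eq_sum_range (fun a => f (a + 1) * g (n - a))]
  simp [hf, hg]

theorem factorCoeff_eq {C : ℕ → ℕ → ℝ} (h0 : ∀ k, C 0 k = 0) (n j : ℕ) :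
    factorCoeff C n j = C n j +
      (if j = 0 then 0 else 1) *
        ∑ x ∈ Finset.HasAntidiagonal.antidiagonal n, factorCoeff C x.1 1 * factorCoeff C x.2 (j + 1) +
      ∑ x ∈ Finset.HasAntidiagonal.antidiagonal n, factorCoeff C x.1 0 * factorCoeff C x.2 (j + 2) := by
  cases n with
  | zero => simp [factorCoeff_zero, h0]
  | succ n =>
    rw [sum_antidiagonal_succ_eq_sum_fin (f := fun m => factorCoeff C m 1)
        (g := fun m => factorCoeff C m (j + 1)) (factorCoeff_zero C _) (factorCoeff_zero C _),
      sum_antidiagonal_succ_eq_sum_fin (f := fun m => factorCoeff C m 0)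
        (g := fun m => factorCoeff C m (j + 2)) (factorCoeff_zero C _) (factorCoeff_zero C _),
      factorCoeff, Finset.sum_add_distrib, add_assoc]
    split_ifs <;> simp

theorem sum_antidiagonal_mul_pow (f g : ℕ → ℝ) (z : ℝ) (n : ℕ) :
    (∑ x ∈ Finset.HasAntidiagonal.antidiagonal n, f x.1 * g x.2) * z ^ n =
      ∑ x ∈ Finset.HasAntidiagonal.antidiagonal n, (f x.1 * z ^ x.1) * (g x.2 * z ^ x.2) := by
  rw [Finset.sum_mul]
  refine Finset.sum_congr rfl fun x hx => ?_
  rw [← Finset.HasAntidiagonal.mem_antidiagonal.1 hx, pow_add]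
  ring

theorem sum_range_antidiagonal_le {f g : ℕ → ℝ} (hf : ∀ n, 0 ≤ f n) (hg : ∀ n, 0 ≤ g n)
    (hf0 : f 0 = 0) (hg0 : g 0 = 0) (N : ℕ) :
    ∑ n ∈ Finset.range (N + 1), ∑ x ∈ Finset.HasAntidiagonal.antidiagonal n, f x.1 * g x.2 ≤
      (∑ n ∈ Finset.range N, f n) * ∑ n ∈ Finset.range N, g n := by
  rw [Finset.sum_mul_sum, ← Finset.sum_product']
  have hnn : ∀ x : ℕ × ℕ, 0 ≤ f x.1 * g x.2 := fun x => mul_nonneg (hf _) (hg _)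
  calc ∑ n ∈ Finset.range (N + 1), ∑ x ∈ Finset.HasAntidiagonal.antidiagonal n, f x.1 * g x.2
      ≤ ∑ n ∈ Finset.range (N + 1),
          ∑ x ∈ Finset.range N ×ˢ Finset.range N with x.1 + x.2 = n, f x.1 * g x.2 := by
        refine Finset.sum_le_sum fun n hn => ?_
        rw [← Finset.sum_filter_ne_zero]
        refine Finset.sum_le_sum_of_subset_of_nonneg (fun x hx => ?_) fun x _ _ => hnn x
        simp only [Finset.mem_filter, Finset.HasAntidiagonal.mem_antidiagonal, Finset.mem_range,
          Finset.mem_product] at hx hn ⊢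
        have h1 : x.1 ≠ 0 := fun h => hx.2 (by rw [h, hf0, zero_mul])
        have h2 : x.2 ≠ 0 := fun h => hx.2 (by rw [h, hg0, mul_zero])
        omega
    _ ≤ ∑ x ∈ Finset.range N ×ˢ Finset.range N, f x.1 * g x.2 :=
        Finset.sum_fiberwise_le_sum_of_sum_fiber_nonneg fun n _ =>
          Finset.sum_nonneg fun x _ => hnn x

theorem sum_range_factorCoeff_le {C : ℕ → ℕ → ℝ} (hC : ∀ i k, 0 ≤ C i k) (h0 : ∀ k, C 0 k = 0)
    {r ρ M : ℝ} (hr : 0 ≤ r) (hρ : 0 < ρ) (hM : 8 * M ≤ ρ ^ 2)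
    (hsum : ∀ N j, (∑ n ∈ Finset.range N, C n j * r ^ n) * ρ ^ j ≤ M) (N j : ℕ) :
    (∑ n ∈ Finset.range N, factorCoeff C n j * r ^ n) * ρ ^ j ≤ 2 * M := by
  have hM0 : 0 ≤ M := by simpa using hsum 0 0
  have hnn : ∀ j n, 0 ≤ factorCoeff C n j * r ^ n := fun j n =>
    mul_nonneg (factorCoeff_nonneg hC n j) (pow_nonneg hr n)
  induction N generalizing j with
  | zero => simpa using hM0
  | succ N ih =>
    have key : ∀ i k, (∑ n ∈ Finset.range (N + 1), (∑ x ∈ Finset.HasAntidiagonal.antidiagonal n,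
        factorCoeff C x.1 i * factorCoeff C x.2 k) * r ^ n) * ρ ^ (i + k) ≤ 4 * M ^ 2 := by
      intro i k
      simp only [sum_antidiagonal_mul_pow (fun m => factorCoeff C m i) (fun m => factorCoeff C m k)]
      have h1 := sum_range_antidiagonal_le (hnn i) (hnn k) (by simp [factorCoeff_zero])
        (by simp [factorCoeff_zero]) N
      calc _ ≤ _ := mul_le_mul_of_nonneg_right h1 (by positivity)
        _ = ((∑ n ∈ Finset.range N, factorCoeff C n i * r ^ n) * ρ ^ i) *
            ((∑ n ∈ Finset.range N, factorCoeff C n k * r ^ n) * ρ ^ k) := by ring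
        _ ≤ (2 * M) * (2 * M) := mul_le_mul (ih i) (ih k)
            (mul_nonneg (Finset.sum_nonneg fun n _ => hnn k n) (by positivity)) (by positivity)
        _ = 4 * M ^ 2 := by ring
    have k1 := key 1 (j + 1)
    have k0 := key 0 (j + 2)
    have hc := hsum (N + 1) j
    have expand : ∑ n ∈ Finset.range (N + 1), factorCoeff C n j * r ^ n =
        ∑ n ∈ Finset.range (N + 1), C n j * r ^ n +
        (if j = 0 then 0 else 1) * ∑ n ∈ Finset.range (N + 1), (∑ x ∈ Finset.HasAntidiagonal.antidiagonal n,
          factorCoeff C x.1 1 * factorCoeff C x.2 (j + 1)) * r ^ n +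
        ∑ n ∈ Finset.range (N + 1), (∑ x ∈ Finset.HasAntidiagonal.antidiagonal n,
          factorCoeff C x.1 0 * factorCoeff C x.2 (j + 2)) * r ^ n := by
      rw [Finset.mul_sum, ← Finset.sum_add_distrib, ← Finset.sum_add_distrib]
      refine Finset.sum_congr rfl fun n _ => ?_
      rw [factorCoeff_eq h0]
      ring
    rw [expand]
    have hA : 0 ≤ ∑ n ∈ Finset.range (N + 1), (∑ x ∈ Finset.HasAntidiagonal.antidiagonal n,
        factorCoeff C x.1 1 * factorCoeff C x.2 (j + 1)) * r ^ n :=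
      Finset.sum_nonneg fun n _ => mul_nonneg (Finset.sum_nonneg fun x _ =>
        mul_nonneg (factorCoeff_nonneg hC _ _) (factorCoeff_nonneg hC _ _)) (pow_nonneg hr n)
    generalize (∑ n ∈ Finset.range (N + 1), (∑ x ∈ Finset.HasAntidiagonal.antidiagonal n,
        factorCoeff C x.1 1 * factorCoeff C x.2 (j + 1)) * r ^ n) = A at *
    generalize (∑ n ∈ Finset.range (N + 1), (∑ x ∈ Finset.HasAntidiagonal.antidiagonal n,
        factorCoeff C x.1 0 * factorCoeff C x.2 (j + 2)) * r ^ n) = B at *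
    generalize (∑ n ∈ Finset.range (N + 1), C n j * r ^ n) = D at *
    have hA' : (if j = 0 then 0 else 1) * A ≤ A := by split_ifs <;> simp [hA]
    have hmain : ((D + (if j = 0 then 0 else 1) * A + B) * ρ ^ j) * ρ ^ 2 ≤ (2 * M) * ρ ^ 2 := by
      have e1 : A * ρ ^ j * ρ ^ 2 ≤ 4 * M ^ 2 := by
        rw [mul_assoc, ← pow_add, show j + 2 = 1 + (j + 1) by ring]; exact k1
      have e0 : B * ρ ^ j * ρ ^ 2 ≤ 4 * M ^ 2 := by
        rw [mul_assoc, ← pow_add, show j + 2 = 0 + (j + 2) by ring]; exact k0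
      have e2 : (if j = 0 then 0 else 1) * A * (ρ ^ j * ρ ^ 2) ≤ A * (ρ ^ j * ρ ^ 2) :=
        mul_le_mul_of_nonneg_right hA' (by positivity)
      have e3 : D * ρ ^ j * ρ ^ 2 ≤ M * ρ ^ 2 := mul_le_mul_of_nonneg_right hc (by positivity)
      nlinarith
    exact le_of_mul_le_mul_right hmain (by positivity)

/-- The factorization `u ^ 2 - C(z, u) = (u ^ 2 - p * u - q) * (1 - Q)` at a given value of `z`,
in terms of `c j = [u ^ j] C` and the values `x 0 = q`, `x 1 = p`, `x (k + 2) = [u ^ k] Q`. -/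
theorem sq_eq_of_sq_eq_tsum {c x : ℕ → ℝ} {ρ u : ℝ} (hρ : 0 < ρ) (hu : |u| ≤ ρ / 2)
    (hx0 : ∀ j, 0 ≤ x j) (hx : ∀ j, x j * ρ ^ j ≤ ρ ^ 2 / 4)
    (hrec0 : x 0 = c 0 + x 0 * x 2)
    (hrec : ∀ j, x (j + 1) = c (j + 1) + x 1 * x (j + 2) + x 0 * x (j + 3))
    (hsol : u ^ 2 = ∑' j, c j * u ^ j) : u ^ 2 = x 1 * u + x 0 := by
  have hbound : ∀ k, |x (k + 2) * u ^ k| ≤ 1 / 4 * (1 / 2) ^ k := by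
    intro k
    rw [abs_mul, abs_pow, abs_of_nonneg (hx0 _)]
    have h1 : |u| ^ k ≤ (ρ / 2) ^ k := pow_le_pow_left₀ (abs_nonneg u) hu k
    have h2 := hx (k + 2)
    have h3 : x (k + 2) * ρ ^ k ≤ 1 / 4 := by
      have : (x (k + 2) * ρ ^ k) * ρ ^ 2 ≤ 1 / 4 * ρ ^ 2 := by
        rw [mul_assoc, ← pow_add]; linarith
      exact le_of_mul_le_mul_right this (by positivity)
    calc x (k + 2) * |u| ^ k ≤ x (k + 2) * (ρ / 2) ^ k := mul_le_mul_of_nonneg_left h1 (hx0 _)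
      _ = (x (k + 2) * ρ ^ k) * (1 / 2) ^ k := by rw [div_pow, div_pow, one_pow]; ring
      _ ≤ 1 / 4 * (1 / 2) ^ k := mul_le_mul_of_nonneg_right h3 (by positivity)
  have hgeom : HasSum (fun k : ℕ => (1 / 4 : ℝ) * (1 / 2) ^ k) (1 / 2) := by
    have := hasSum_geometric_two.mul_left (1 / 4 : ℝ)
    norm_num at this ⊢
    exact this
  have hsQ : Summable fun k => x (k + 2) * u ^ k :=
    Summable.of_norm_bounded hgeom.summable hbound
  have hQle : |∑' k, x (k + 2) * u ^ k| ≤ 1 / 2 :=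
    tsum_of_norm_bounded (f := fun k => x (k + 2) * u ^ k) hgeom hbound
  have hQ := hsQ.hasSum
  set Q := ∑' k, x (k + 2) * u ^ k
  have hF1 : HasSum (fun k => x (k + 1) * u ^ k) (u * Q + x 1) := by
    rw [← hasSum_nat_add_iff' 1]
    have h := hQ.mul_left u
    rw [Finset.sum_range_one, pow_zero, mul_one, zero_add, add_sub_cancel_right]
    exact h.congr_fun fun k => by ring
  have hQ1 : HasSum (fun k => x (k + 3) * u ^ (k + 1)) (Q - x 2) := by
    have := (hasSum_nat_add_iff' 1).2 hQ
    simpa using this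
  have hC : HasSum (fun j => c j * u ^ j)
      (u * (u * Q + x 1) - x 1 * (u * Q) - x 0 * (Q - x 2) + c 0) := by
    rw [← hasSum_nat_add_iff' 1]
    have h := ((hF1.mul_left u).sub ((hQ.mul_left u).mul_left (x 1))).sub (hQ1.mul_left (x 0))
    rw [Finset.sum_range_one, pow_zero, mul_one, add_sub_cancel_right]
    exact h.congr_fun fun k => by linear_combination -u ^ (k + 1) * hrec k
  rw [hC.tsum_eq] at hsol
  have hfac : (u ^ 2 - (x 1 * u + x 0)) * (1 - Q) = 0 := by linear_combination hsol - hrec0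
  rcases mul_eq_zero.1 hfac with h | h
  · linarith
  · have := (abs_le.1 hQle).2
    linarith

theorem exists_summable_small {C : ℕ → ℕ → ℝ} (hC : ∀ i k, 0 ≤ C i k) (h0 : ∀ k, C 0 k = 0)
    {s ρ : ℝ} (hs : 0 < s) (hρ : 0 < ρ)
    (hsum : Summable fun p : ℕ × ℕ => C p.1 p.2 * s ^ p.1 * ρ ^ p.2) :
    ∃ r, 0 < r ∧ (Summable fun p : ℕ × ℕ => C p.1 p.2 * r ^ p.1 * ρ ^ p.2) ∧
      8 * ∑' p : ℕ × ℕ, C p.1 p.2 * r ^ p.1 * ρ ^ p.2 ≤ ρ ^ 2 := by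
  have hnn : ∀ p : ℕ × ℕ, 0 ≤ C p.1 p.2 * s ^ p.1 * ρ ^ p.2 := fun p => by
    have := hC p.1 p.2; positivity
  set M := ∑' p : ℕ × ℕ, C p.1 p.2 * s ^ p.1 * ρ ^ p.2 with hM
  have hM0 : 0 ≤ M := tsum_nonneg hnn
  set t := ρ ^ 2 / (8 * M + ρ ^ 2) with ht
  have ht0 : 0 < t := by positivity
  have ht1 : t ≤ 1 := by rw [ht, div_le_one (by positivity)]; linarith
  have hle : ∀ p : ℕ × ℕ, C p.1 p.2 * (t * s) ^ p.1 * ρ ^ p.2 ≤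
      t * (C p.1 p.2 * s ^ p.1 * ρ ^ p.2) := by
    rintro ⟨i, k⟩
    cases i with
    | zero => simp [h0]
    | succ i =>
      have h1 : t ^ (i + 1) ≤ t := pow_le_of_le_one ht0.le ht1 (by omega)
      calc C (i + 1) k * (t * s) ^ (i + 1) * ρ ^ k
          = t ^ (i + 1) * (C (i + 1) k * s ^ (i + 1) * ρ ^ k) := by rw [mul_pow]; ring
        _ ≤ _ := mul_le_mul_of_nonneg_right h1 (hnn (i + 1, k))
  have hsm : Summable fun p : ℕ × ℕ => C p.1 p.2 * (t * s) ^ p.1 * ρ ^ p.2 :=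
    Summable.of_nonneg_of_le (fun p => by have := hC p.1 p.2; positivity) hle (hsum.mul_left t)
  refine ⟨t * s, by positivity, hsm, ?_⟩
  have h1 := hsm.tsum_le_tsum hle (hsum.mul_left t)
  rw [tsum_mul_left, ← hM] at h1
  have h2 : 8 * (t * M) ≤ ρ ^ 2 := by
    rw [ht, div_mul_eq_mul_div, mul_div_assoc', div_le_iff₀ (by positivity)]
    nlinarith [sq_nonneg (ρ ^ 2)]
  linarith

open Set

/-- Let `C(z,u) = ∑_{i,k} Cc i k z^i u^k` have non-negative coefficients with
`z ∣ C` and `u² ∤ C`, and let `u₁, u₂` be the two solutions with `u(0) = 0` of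
`u² = C(z,u)` (nondegenerate: `u₁ ≠ u₂` for small `z > 0`).  Then
`g = (u₁+u₂)/2` and `h = ((u₁-u₂)/2)²` are power series with non-negative coefficients
vanishing at `0`. -/
theorem stmt9 (Cc : ℕ → ℕ → ℝ) (hnn : ∀ i k, 0 ≤ Cc i k)
    (hzdvd : ∀ k, Cc 0 k = 0)
    (hu2 : ∃ i, Cc i 0 ≠ 0 ∨ Cc i 1 ≠ 0)
    (u1 u2 : ℝ → ℝ) (ε : ℝ) (hε : 0 < ε)
    (hc1 : ContinuousOn u1 (Ico 0 ε)) (hc2 : ContinuousOn u2 (Ico 0 ε))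
    (h10 : u1 0 = 0) (h20 : u2 0 = 0)
    (hne : ∀ z ∈ Ioo 0 ε, u1 z ≠ u2 z)
    (heq1 : ∀ z ∈ Ico 0 ε,
      (u1 z) ^ 2 = ∑' p : ℕ × ℕ, Cc p.1 p.2 * z ^ p.1 * (u1 z) ^ p.2)
    (heq2 : ∀ z ∈ Ico 0 ε,
      (u2 z) ^ 2 = ∑' p : ℕ × ℕ, Cc p.1 p.2 * z ^ p.1 * (u2 z) ^ p.2) :
    ∃ (a b : ℕ → ℝ) (δ : ℝ), 0 < δ ∧
      (∀ n, 0 ≤ a n) ∧ (∀ n, 0 ≤ b n) ∧ a 0 = 0 ∧ b 0 = 0 ∧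
      ∀ z ∈ Ico 0 δ,
        (u1 z + u2 z) / 2 = ∑' n : ℕ, a n * z ^ n ∧
        ((u1 z - u2 z) / 2) ^ 2 = ∑' n : ℕ, b n * z ^ n := by
  obtain ⟨s, ρ, hs, hρ, hsum⟩ : ∃ s ρ : ℝ, 0 < s ∧ 0 < ρ ∧
      Summable fun p : ℕ × ℕ => Cc p.1 p.2 * s ^ p.1 * ρ ^ p.2 := by
    have of_ne : ∀ v : ℝ, v ≠ 0 →
        v ^ 2 = ∑' p : ℕ × ℕ, Cc p.1 p.2 * (ε / 2) ^ p.1 * v ^ p.2 →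
        ∃ s ρ : ℝ, 0 < s ∧ 0 < ρ ∧
          Summable fun p : ℕ × ℕ => Cc p.1 p.2 * s ^ p.1 * ρ ^ p.2 := by
      intro v hv h
      refine ⟨ε / 2, |v|, by positivity, by positivity, ?_⟩
      have hsm : Summable fun p : ℕ × ℕ => Cc p.1 p.2 * (ε / 2) ^ p.1 * v ^ p.2 := by
        by_contra hcon
        rw [tsum_eq_zero_of_not_summable hcon] at h
        exact hv (pow_eq_zero_iff two_ne_zero |>.1 h)
      refine (summable_congr fun p => ?_).1 hsm.abs
      rw [abs_mul, abs_mul, abs_pow, abs_pow, abs_of_nonneg (hnn _ _),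
        abs_of_pos (half_pos hε)]
    have hmem : ε / 2 ∈ Ico 0 ε := ⟨by linarith, by linarith⟩
    by_cases h : u1 (ε / 2) = 0
    · refine of_ne (u2 (ε / 2)) (fun h' => ?_) (heq2 _ hmem)
      exact hne (ε / 2) ⟨by linarith, by linarith⟩ (h.trans h'.symm)
    · exact of_ne _ h (heq1 _ hmem)
  obtain ⟨r, hr, hsr, hMr⟩ := exists_summable_small hnn hzdvd hs hρ hsum
  set M := ∑' p : ℕ × ℕ, Cc p.1 p.2 * r ^ p.1 * ρ ^ p.2 with hM
  have hpart : ∀ N j, (∑ n ∈ Finset.range N, Cc n j * r ^ n) * ρ ^ j ≤ M := by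
    intro N j
    have h := hsr.sum_le_tsum ((Finset.range N) ×ˢ {j})
      (fun p _ => by have := hnn p.1 p.2; positivity)
    rw [Finset.sum_product] at h
    simpa [Finset.sum_mul] using h
  have hXnn := factorCoeff_nonneg hnn
  set X := factorCoeff Cc with hX
  have hbd := sum_range_factorCoeff_le hnn hzdvd hr.le hρ hMr hpart
  rw [← hX] at hbd
  have hXr : ∀ j, Summable fun n => X n j * r ^ n := fun j =>
    summable_of_sum_range_le (c := 2 * M / ρ ^ j)
      (fun n => mul_nonneg (hXnn n j) (pow_nonneg hr.le n))
      (fun N => by rw [le_div_iff₀ (by positivity)]; exact hbd N j)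
  have hXz : ∀ z ∈ Icc 0 r, ∀ j, Summable fun n => X n j * z ^ n := fun z hz j =>
    Summable.of_nonneg_of_le (fun n => mul_nonneg (hXnn n j) (pow_nonneg hz.1 n))
      (fun n => mul_le_mul_of_nonneg_left (pow_le_pow_left₀ hz.1 hz.2 n) (hXnn n j)) (hXr j)
  have hmul : ∀ z ∈ Icc 0 r, ∀ i k,
      HasSum (fun n => (∑ x ∈ Finset.HasAntidiagonal.antidiagonal n, X x.1 i * X x.2 k) * z ^ n)
        ((∑' n, X n i * z ^ n) * ∑' n, X n k * z ^ n) := by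
    intro z hz i k
    simp only [sum_antidiagonal_mul_pow (fun m => X m i) (fun m => X m k)]
    have hi := (hXz z hz i).norm
    have hk := (hXz z hz k).norm
    rw [tsum_mul_tsum_eq_tsum_sum_antidiagonal_of_summable_norm hi hk]
    exact (summable_norm_sum_mul_antidiagonal_of_summable_norm hi hk).of_norm.hasSum
  have hroot : ∀ z ∈ Icc 0 r, ∀ u : ℝ, |u| ≤ ρ / 2 →
      u ^ 2 = ∑' p : ℕ × ℕ, Cc p.1 p.2 * z ^ p.1 * u ^ p.2 →
      u ^ 2 = (∑' n, X n 1 * z ^ n) * u + ∑' n, X n 0 * z ^ n := by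
    intro z hz u hu hsol
    have hCs : Summable fun p : ℕ × ℕ => Cc p.1 p.2 * z ^ p.1 * u ^ p.2 := by
      refine Summable.of_norm_bounded hsr fun p => ?_
      rw [Real.norm_eq_abs, abs_mul, abs_mul, abs_pow, abs_pow, abs_of_nonneg (hnn _ _),
        abs_of_nonneg hz.1]
      have := hnn p.1 p.2
      have := hz.1
      have := hz.2
      have : |u| ≤ ρ := by linarith
      gcongr
    have hCz : ∀ j, Summable fun n => Cc n j * z ^ n := by
      intro j
      refine Summable.of_nonneg_of_le (fun n => mul_nonneg (hnn n j) (pow_nonneg hz.1 n))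
        (fun n => mul_le_mul_of_nonneg_left (pow_le_pow_left₀ hz.1 hz.2 n) (hnn n j)) ?_
      refine summable_of_sum_range_le (c := M / ρ ^ j)
        (fun n => mul_nonneg (hnn n j) (pow_nonneg hr.le n))
        (fun N => by rw [le_div_iff₀ (by positivity)]; exact hpart N j)
    have hrec : ∀ j, ∑' n, X n j * z ^ n = ∑' n, Cc n j * z ^ n +
        (if j = 0 then 0 else 1) * ((∑' n, X n 1 * z ^ n) * ∑' n, X n (j + 1) * z ^ n) +
        (∑' n, X n 0 * z ^ n) * ∑' n, X n (j + 2) * z ^ n := by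
      intro j
      have h := ((hCz j).hasSum.add ((hmul z hz 1 (j + 1)).mul_left
        (if j = 0 then 0 else 1))).add (hmul z hz 0 (j + 2))
      rw [← h.tsum_eq]
      refine tsum_congr fun n => ?_
      rw [hX, factorCoeff_eq hzdvd]
      ring
    refine sq_eq_of_sq_eq_tsum (c := fun j => ∑' n, Cc n j * z ^ n)
      (x := fun j => ∑' n, X n j * z ^ n) hρ hu
      (fun j => tsum_nonneg fun n => mul_nonneg (hXnn n j) (pow_nonneg hz.1 n)) ?_ ?_ ?_ ?_
    · intro j
      have h1 : ∑' n, X n j * z ^ n ≤ 2 * M / ρ ^ j := by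
        refine Real.tsum_le_of_sum_range_le
          (fun n => mul_nonneg (hXnn n j) (pow_nonneg hz.1 n)) fun N => ?_
        rw [le_div_iff₀ (by positivity)]
        refine le_trans ?_ (hbd N j)
        gcongr with n _
        · exact hXnn n j
        · exact hz.1
        · exact hz.2
      rw [le_div_iff₀ (by positivity)] at h1
      linarith
    · simpa using hrec 0
    · intro j
      simpa using hrec (j + 1)
    · rw [hsol, ← (Equiv.prodComm ℕ ℕ).tsum_eq, Summable.tsum_prod]
      · exact tsum_congr fun j => by simp [tsum_mul_right]
      · exact (Equiv.prodComm ℕ ℕ).summable_iff.2 hCs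
  have hsmall : ∀ v : ℝ → ℝ, ContinuousOn v (Ico 0 ε) → v 0 = 0 →
      ∃ η > 0, ∀ z ∈ Ico 0 ε, z < η → |v z| ≤ ρ / 2 := by
    intro v hv hv0
    obtain ⟨η, hη, h⟩ := Metric.continuousOn_iff.1 hv 0 ⟨le_rfl, hε⟩ (ρ / 2) (half_pos hρ)
    refine ⟨η, hη, fun z hz hzη => ?_⟩
    have := h z hz (by rwa [Real.dist_eq, sub_zero, abs_of_nonneg hz.1])
    rw [hv0, Real.dist_eq, sub_zero] at this
    exact this.le
  obtain ⟨η₁, hη₁, hs1⟩ := hsmall u1 hc1 h10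
  obtain ⟨η₂, hη₂, hs2⟩ := hsmall u2 hc2 h20
  have hX0 : ∀ j, X 0 j = 0 := factorCoeff_zero Cc
  refine ⟨fun n => X n 1 / 2,
    fun n => (∑ x ∈ Finset.HasAntidiagonal.antidiagonal n, X x.1 1 * X x.2 1) / 4 + X n 0,
    min (min η₁ η₂) (min r ε), by positivity, fun n => by have := hXnn n 1; positivity,
    fun n => ?_, by simp [hX0], by simp [hX0], ?_⟩
  · exact add_nonneg (div_nonneg (Finset.sum_nonneg fun x _ => mul_nonneg (hXnn _ _) (hXnn _ _))
      (by norm_num)) (hXnn _ _)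
  · rintro z ⟨hz0, hz⟩
    simp only [lt_min_iff] at hz
    obtain ⟨⟨hz1, hz2⟩, hzr, hzε⟩ := hz
    have hzI : z ∈ Icc 0 r := ⟨hz0, hzr.le⟩
    have hzE : z ∈ Ico 0 ε := ⟨hz0, hzε⟩
    have ha : ∑' n, X n 1 / 2 * z ^ n = (∑' n, X n 1 * z ^ n) / 2 := by
      rw [← tsum_div_const]
      exact tsum_congr fun n => by ring
    have hb : ∑' n, ((∑ x ∈ Finset.HasAntidiagonal.antidiagonal n, X x.1 1 * X x.2 1) / 4 + X n 0) * z ^ n =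
        (∑' n, X n 1 * z ^ n) ^ 2 / 4 + ∑' n, X n 0 * z ^ n := by
      have := ((hmul z hzI 1 1).div_const 4).add (hXz z hzI 0).hasSum
      rw [sq, ← this.tsum_eq]
      exact tsum_congr fun n => by ring
    rw [ha, hb]
    rcases hz0.eq_or_lt with rfl | hzpos
    · have hv : ∀ j, ∑' n, X n j * (0 : ℝ) ^ n = 0 := fun j => by
        rw [tsum_eq_single 0 fun n hn => by simp [hn]]
        simp [hX0]
      simp [hv, h10, h20]
    · have r1 := hroot z hzI _ (hs1 z hzE hz1) (heq1 z hzE)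
      have r2 := hroot z hzI _ (hs2 z hzE hz2) (heq2 z hzE)
      have hd : u1 z - u2 z ≠ 0 := sub_ne_zero.2 (hne z ⟨hzpos, hzε⟩)
      have hp : u1 z + u2 z = ∑' n, X n 1 * z ^ n :=
        mul_left_cancel₀ hd (by linear_combination r1 - r2)
      rw [← hp] at r1 ⊢
      exact ⟨rfl, by linear_combination r1⟩
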